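/- Let v ≥ 2 and b ≥ 1 be integers, ε > 0, and η ∈ (0, 1]. For every ε-LDP mechanism q ∈ ℝ^{v×b}, min over distinct pairs h ≠ h' in [v] of C(q̃_{h,η}, q̃_{h',η}) ≤ −log(1 − ((v + η² − 1)(e^{ε/2} − 1)²)/(v²(v−1)) · max_{k ∈ {0,1,…,v}} k(v−k)/f(v,k,ε)), where f(v,k,ε) = (k·e^ε + v − k)/v. -/

import Mathlib

/-- Chord bound for the concave function `u ↦ u ^ s` on `[1, E]`. -/
theorem one_add_chord_le_rpow {E u s : ℝ} (hE : 1 < E) (hu : 1 ≤ u) (huE : u ≤ E)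
    (hs0 : 0 ≤ s) (hs1 : s ≤ 1) :
    1 + (u - 1) * ((E ^ s - 1) / (E - 1)) ≤ u ^ s := by
  have hE' : 0 < E - 1 := by linarith
  have h := (Real.concaveOn_rpow hs0 hs1).2 (Set.mem_Ici.2 zero_le_one)
    (Set.mem_Ici.2 (zero_le_one.trans hE.le))
    (div_nonneg (sub_nonneg.2 huE) hE'.le) (div_nonneg (sub_nonneg.2 hu) hE'.le)
    (by field_simp; ring)
  simp only [smul_eq_mul, Real.one_rpow, mul_one] at h
  have e1 : (E - u) / (E - 1) + (u - 1) / (E - 1) * E = u := by field_simp; ring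
  rw [e1] at h
  refine le_trans (le_of_eq ?_) h
  field_simp
  ring

theorem add_chord_le_rpow_mul_rpow {E p r s : ℝ} (hE : 1 < E) (hr : 0 ≤ r) (hrp : r ≤ p)
    (hpE : p ≤ E * r) (hs0 : 0 ≤ s) (hs1 : s ≤ 1) :
    r + (p - r) * ((E ^ s - 1) / (E - 1)) ≤ p ^ s * r ^ (1 - s) := by
  rcases hr.eq_or_lt with rfl | hr
  · obtain rfl : p = 0 := by linarith
    simp only [sub_self, zero_mul, add_zero]
    positivity
  · have h := one_add_chord_le_rpow hE ((one_le_div hr).2 hrp) ((div_le_iff₀ hr).2 hpE) hs0 hs1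
    have e : p ^ s * r ^ (1 - s) = r * (p / r) ^ s := by
      rw [Real.rpow_sub hr, Real.rpow_one, Real.div_rpow (by linarith) hr.le]
      ring
    rw [e]
    refine le_trans (le_of_eq ?_) (mul_le_mul_of_nonneg_left h hr.le)
    field_simp

theorem chord_le_rpow_mul_rpow {E p r s : ℝ} (hE : 1 < E) (hp : 0 ≤ p) (hr : 0 ≤ r)
    (hpE : p ≤ E * r) (hrE : r ≤ E * p) (hs0 : 0 ≤ s) (hs1 : s ≤ 1) :
    (p + r - |p - r|) / 2 + (|p - r| + (p - r)) / 2 * ((E ^ s - 1) / (E - 1)) +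
      (|p - r| - (p - r)) / 2 * ((E ^ (1 - s) - 1) / (E - 1)) ≤ p ^ s * r ^ (1 - s) := by
  rcases le_total r p with h | h
  · rw [abs_of_nonneg (sub_nonneg.2 h)]
    refine le_trans (le_of_eq ?_) (add_chord_le_rpow_mul_rpow hE hr h hpE hs0 hs1)
    ring
  · rw [abs_of_nonpos (sub_nonpos.2 h)]
    have h' := add_chord_le_rpow_mul_rpow hE hp h hrE (s := 1 - s) (by linarith) (by linarith)
    rw [sub_sub_cancel, mul_comm (r ^ _)] at h'
    refine le_trans (le_of_eq ?_) h'
    ring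

/-- For probability vectors with likelihood ratios in `[R⁻², R²]`, every Chernoff coefficient is
bounded below in terms of the total variation distance. -/
theorem one_sub_totalVariation_le_sum_rpow {ι : Type*} [Fintype ι] {R s : ℝ} {p r : ι → ℝ}
    (hR : 1 < R) (hp : ∀ y, 0 ≤ p y) (hr : ∀ y, 0 ≤ r y) (hp1 : ∑ y, p y = 1)
    (hr1 : ∑ y, r y = 1) (hpE : ∀ y, p y ≤ R ^ 2 * r y) (hrE : ∀ y, r y ≤ R ^ 2 * p y)
    (hs0 : 0 ≤ s) (hs1 : s ≤ 1) :
    1 - (∑ y, |p y - r y|) / 2 * ((R - 1) / (R + 1)) ≤ ∑ y, p y ^ s * r y ^ (1 - s) := by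
  have hE : 1 < R ^ 2 := by nlinarith
  have hsum := Finset.sum_le_sum fun y (_ : y ∈ Finset.univ) =>
    chord_le_rpow_mul_rpow hE (hp y) (hr y) (hpE y) (hrE y) hs0 hs1
  refine le_trans ?_ hsum
  simp only [Finset.sum_add_distrib, ← Finset.sum_mul, ← Finset.sum_div, Finset.sum_sub_distrib,
    hp1, hr1]
  have hT : 0 ≤ ∑ y, |p y - r y| := Finset.sum_nonneg fun y _ => abs_nonneg _
  set T := ∑ y, |p y - r y|
  have hmul : (R ^ 2) ^ s * (R ^ 2) ^ (1 - s) = R ^ 2 := by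
    rw [← Real.rpow_add (by positivity)]; simp
  have hx : 0 < (R ^ 2) ^ s := by positivity
  have hy : 0 < (R ^ 2) ^ (1 - s) := by positivity
  set x := (R ^ 2) ^ s
  set z := (R ^ 2) ^ (1 - s)
  have hxz : 2 * R ≤ x + z := by
    refine abs_le_of_sq_le_sq' ?_ (by positivity) |>.2
    nlinarith [sq_nonneg (x - z)]
  have hR1 : 0 < R - 1 := by linarith
  have hR2 : 0 < R + 1 := by linarith
  have key : (1 - (R - 1) / (R + 1)) ≤ (x - 1) / (R ^ 2 - 1) + (z - 1) / (R ^ 2 - 1) := by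
    rw [← add_div, le_div_iff₀ (by linarith)]
    have : (1 - (R - 1) / (R + 1)) * (R ^ 2 - 1) = 2 * (R - 1) := by field_simp; ring
    rw [this]; linarith
  have := mul_le_mul_of_nonneg_left key (div_nonneg hT zero_le_two)
  linarith

/-- On a box, a convex function is bounded by its values at the vertices. -/
theorem ConvexOn.le_of_vertices {ι : Type*} [Finite ι] {Φ : (ι → ℝ) → ℝ} {c d B : ℝ}
    (hcd : c ≤ d) (hΦ : ConvexOn ℝ Set.univ Φ)
    (hB : ∀ w : ι → ℝ, (∀ i, w i = c ∨ w i = d) → Φ w ≤ B) {a : ι → ℝ}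
    (ha : ∀ i, a i ∈ Set.Icc c d) : Φ a ≤ B := by
  have hmem : a ∈ convexHull ℝ (Set.pi Set.univ fun _ : ι => ({c, d} : Set ℝ)) := by
    rw [convexHull_pi]
    intro i _
    rw [convexHull_pair, segment_eq_Icc hcd]
    exact ha i
  obtain ⟨w, hw, hle⟩ := (hΦ.subset (Set.subset_univ _) (convex_convexHull ℝ _)
    ).exists_ge_of_mem_convexHull (subset_convexHull ℝ _) hmem
  exact hle.trans (hB w fun i => by simpa using hw i (Set.mem_univ i))

theorem sum_abs_sub_two_valued {ι : Type*} [Fintype ι] {c d : ℝ} (hcd : c ≤ d) (S : Finset ι)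
    [DecidableEq ι] {w : ι → ℝ} (hw : ∀ i, w i = if i ∈ S then d else c) :
    ∑ i, ∑ j, |w i - w j| =
      2 * ((S.card : ℝ) * (Fintype.card ι - S.card)) * (d - c) := by
  have h : ∀ i j, |w i - w j| = (d - c) *
      ((if i ∈ S then (1 : ℝ) else 0) * (1 - if j ∈ S then 1 else 0)
      + (1 - if i ∈ S then (1 : ℝ) else 0) * (if j ∈ S then 1 else 0)) := by
    intro i j
    rw [hw, hw]
    split_ifs <;> simp [abs_of_nonneg, hcd, abs_sub_comm c d]
  simp only [h, ← Finset.mul_sum, Finset.sum_add_distrib, ← Finset.sum_mul,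
    Finset.sum_sub_distrib]
  simp
  ring

theorem convexOn_sum_abs_sub {ι : Type*} [Fintype ι] (K : ℝ) :
    ConvexOn ℝ Set.univ fun w : ι → ℝ => ∑ i, ∑ j, |w i - w j| - K * ∑ i, w i := by
  refine ⟨convex_univ, fun x _ y _ a b ha hb _ => ?_⟩
  simp only [Pi.add_apply, Pi.smul_apply, smul_eq_mul, Finset.sum_add_distrib, ← Finset.mul_sum]
  have : ∑ i, ∑ j, |a * x i + b * y i - (a * x j + b * y j)| ≤
      a * ∑ i, ∑ j, |x i - x j| + b * ∑ i, ∑ j, |y i - y j| := by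
    simp only [Finset.mul_sum, ← Finset.sum_add_distrib]
    refine Finset.sum_le_sum fun i _ => Finset.sum_le_sum fun j _ => ?_
    calc _ = |a * (x i - x j) + b * (y i - y j)| := by congr 1; ring
      _ ≤ |a * (x i - x j)| + |b * (y i - y j)| := abs_add_le _ _
      _ = _ := by rw [abs_mul, abs_mul, abs_of_nonneg ha, abs_of_nonneg hb]
  linarith

/-- Pairwise spread of a nonnegative vector whose entries are within a factor `E` of each other. -/
theorem sum_abs_sub_le_of_ratio_le {v : ℕ} (hv : 0 < v) {E M : ℝ} (hE : 1 < E)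
    (hM : ∀ k : ℕ, k ≤ v → (k : ℝ) * (v - k) / ((k * E + v - k) / v) ≤ M)
    {a : Fin v → ℝ} (ha : ∀ i, 0 ≤ a i) (haE : ∀ i j, a i ≤ E * a j) :
    ∑ i, ∑ j, |a i - a j| ≤ 2 * (E - 1) * M / v * ∑ i, a i := by
  classical
  have hv' : (0 : ℝ) < v := by exact_mod_cast hv
  have : Nonempty (Fin v) := ⟨⟨0, hv⟩⟩
  obtain ⟨m, hm⟩ := Finite.exists_min a
  have hc : 0 ≤ a m := ha m
  have hcd : a m ≤ E * a m := by nlinarith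
  suffices h : ∑ i, ∑ j, |a i - a j| - 2 * (E - 1) * M / v * ∑ i, a i ≤ 0 by linarith
  refine (convexOn_sum_abs_sub _).le_of_vertices hcd (fun w hw => ?_) fun i => ⟨hm i, haE i m⟩
  set S := Finset.univ.filter fun i => w i = E * a m
  have hwS : ∀ i, w i = if i ∈ S then E * a m else a m := by
    intro i
    by_cases h : w i = E * a m
    · simp [S, h]
    · simpa [S, h] using (hw i).resolve_right h
  have hk : S.card ≤ v := by simpa using S.card_le_univ
  have hsum : ∑ i, w i = a m * (S.card * E + v - S.card) := by
    have : ∀ i, w i = a m * (1 + (E - 1) * if i ∈ S then (1 : ℝ) else 0) := by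
      intro i; rw [hwS]; split_ifs <;> ring
    simp only [this, ← Finset.mul_sum, Finset.sum_add_distrib]
    simp
    left; ring
  rw [sum_abs_sub_two_valued hcd S hwS, hsum, Fintype.card_fin]
  have hkv : (S.card : ℝ) ≤ v := by exact_mod_cast hk
  have hden : 0 < (S.card : ℝ) * E + v - S.card := by
    have : (0 : ℝ) ≤ S.card * (E - 1) := mul_nonneg (Nat.cast_nonneg _) (by linarith)
    linarith
  have h := hM S.card hk
  rw [div_le_iff₀ (by positivity)] at h
  have h2 := mul_le_mul_of_nonneg_left h
    (mul_nonneg zero_le_two (mul_nonneg (sub_nonneg.2 hE.le) hc))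
  have e : 2 * (E - 1) * M / v * (a m * (S.card * E + v - S.card)) =
      2 * ((E - 1) * a m) * (M * ((S.card * E + v - S.card) / v)) := by ring
  rw [e]
  linarith

/-- Some pair of distinct rows is at most as far apart as the average pair. -/
theorem exists_pair_le_of_sum_le {v : ℕ} (hv : 2 ≤ v) {T : Fin v → Fin v → ℝ} {B : ℝ}
    (hT : ∀ h, T h h = 0) (hB : ∑ h, ∑ h', T h h' ≤ B) :
    ∃ h h', h ≠ h' ∧ T h h' ≤ B / (v * (v - 1)) := by
  by_contra! hcon
  have hv' : (2 : ℝ) ≤ v := by exact_mod_cast hv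
  have hlt : ∑ x ∈ (Finset.univ : Finset (Fin v)).offDiag, B / (v * (v - 1) : ℝ) <
      ∑ x ∈ (Finset.univ : Finset (Fin v)).offDiag, T x.1 x.2 := by
    refine Finset.sum_lt_sum_of_nonempty ?_ fun x hx => hcon _ _ (Finset.mem_offDiag.1 hx).2.2
    exact ⟨(⟨0, by omega⟩, ⟨1, by omega⟩), by simp⟩
  have e : ∑ x ∈ (Finset.univ : Finset (Fin v)).offDiag, T x.1 x.2 = ∑ h, ∑ h', T h h' := by
    rw [← Fintype.sum_prod_type']
    refine Finset.sum_subset (Finset.subset_univ _) fun x _ hx => ?_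
    have : x.1 = x.2 := by simpa using hx
    rw [this, hT]
  rw [e, Finset.sum_const, Finset.offDiag_card, nsmul_eq_mul] at hlt
  simp only [Finset.card_univ, Fintype.card_fin] at hlt
  rw [Nat.cast_sub (Nat.le_mul_self v), Nat.cast_mul] at hlt
  have : ((v : ℝ) * v - v) * (B / (v * (v - 1))) = B := by
    have : (v : ℝ) - 1 ≠ 0 := by linarith
    field_simp
  linarith

/-- converse, symmetric testing: For every ε-LDP mechanism `q`, the
minimum pairwise Chernoff information of the perturbed smoothed point mass
distributions is at most
`-log(1 - ((v + η² - 1)(e^{ε/2} - 1)²)/(v²(v-1)) · max_k k(v-k)/f(v,k,ε))`. -/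
theorem stmt_9 (v b : ℕ) (hv : 2 ≤ v) (hb : 1 ≤ b) (ε η : ℝ) (hε : 0 < ε)
    (hη : η ∈ Set.Ioc (0 : ℝ) 1)
    (q : Fin v → Fin b → ℝ)
    (hq_nonneg : ∀ x y, 0 ≤ q x y)
    (hq_row : ∀ x, ∑ y, q x y = 1)
    (hq_ldp : ∀ x x' y, q x y ≤ Real.exp ε * q x' y)
    (qt : Fin v → Fin b → ℝ)
    (hqt : ∀ h y, qt h y =
      ∑ x, (η * (if h = x then 1 else 0) + (1 - η) / v) * q x y) :
    sInf {r : ℝ | ∃ h h' : Fin v, h ≠ h' ∧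
        r = -Real.log (sInf ((fun s : ℝ =>
          ∑ y, (qt h y) ^ s * (qt h' y) ^ (1 - s)) '' Set.Icc (0 : ℝ) 1))} ≤
      -Real.log (1 - (((v : ℝ) + η ^ 2 - 1) * (Real.exp (ε / 2) - 1) ^ 2) /
          ((v : ℝ) ^ 2 * ((v : ℝ) - 1)) *
        ⨆ k : Fin (v + 1),
          ((k.1 : ℝ) * ((v : ℝ) - k.1)) /
            (((k.1 : ℝ) * Real.exp ε + (v : ℝ) - k.1) / v)) := by
  obtain ⟨hη0, hη1⟩ := hη
  have hv2 : (2 : ℝ) ≤ v := by exact_mod_cast hv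
  have hv1 : (0 : ℝ) < v - 1 := by linarith
  have hR : 1 < Real.exp (ε / 2) := Real.one_lt_exp_iff.2 (by linarith)
  have hER : Real.exp ε = Real.exp (ε / 2) ^ 2 := by
    rw [← Real.exp_nat_mul]; congr 1; push_cast; ring
  set M := ⨆ k : Fin (v + 1), ((k.1 : ℝ) * ((v : ℝ) - k.1)) /
            (((k.1 : ℝ) * Real.exp ε + (v : ℝ) - k.1) / v) with hMdef
  rw [hER] at hMdef hq_ldp
  set R := Real.exp (ε / 2)
  have hE : 1 < R ^ 2 := by nlinarith
  have hM : ∀ k : ℕ, k ≤ v → (k : ℝ) * (v - k) / ((k * R ^ 2 + v - k) / v) ≤ M := by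
    intro k hk
    rw [hMdef]
    exact le_ciSup (f := fun k : Fin (v + 1) => ((k.1 : ℝ) * ((v : ℝ) - k.1)) /
            (((k.1 : ℝ) * R ^ 2 + (v : ℝ) - k.1) / v)) (Set.finite_range _).bddAbove
            ⟨k, by omega⟩
  have hM0 : 0 ≤ M := by simpa using hM 0 (by omega)
  have hM1 : (R - 1) ^ 2 * M < v * (v - 1) := by
    rw [← lt_div_iff₀' (by nlinarith), hMdef]
    obtain ⟨k, hk⟩ := exists_eq_ciSup_of_finite (f := fun k : Fin (v + 1) =>
      ((k.1 : ℝ) * ((v : ℝ) - k.1)) / (((k.1 : ℝ) * R ^ 2 + (v : ℝ) - k.1) / v))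
    rw [← hk]
    have hkv : ((k.1 : ℕ) : ℝ) ≤ v := by exact_mod_cast Nat.lt_succ_iff.1 k.2
    rcases Nat.eq_zero_or_pos k.1 with h0 | h0
    · simp only [h0, Nat.cast_zero, zero_mul, zero_div]
      exact div_pos (by nlinarith) (by nlinarith)
    · have hk1 : (1 : ℝ) ≤ (k.1 : ℕ) := by exact_mod_cast h0
      generalize ((k.1 : ℕ) : ℝ) = x at *
      have hden : 0 < x * R ^ 2 + v - x := by nlinarith
      rw [div_lt_div_iff₀ (by positivity) (by nlinarith)]
      have hsq : (R - 1) ^ 2 ≤ R ^ 2 := by nlinarith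
      have h1 : x * (v - x) * (R - 1) ^ 2 < (v - 1) * (x * R ^ 2 + v - x) := by
        rcases hkv.eq_or_lt with rfl | hlt
        · nlinarith [mul_pos hv1 hden]
        · have h2 : x * (v - x) * (R - 1) ^ 2 ≤ x * (v - x) * R ^ 2 :=
            mul_le_mul_of_nonneg_left hsq (by nlinarith)
          have h3 : (v - x) * (x * R ^ 2) ≤ (v - 1) * (x * R ^ 2) :=
            mul_le_mul_of_nonneg_right (by linarith) (by positivity)
          nlinarith [mul_pos hv1 (sub_pos.2 hlt)]
      calc x * (v - x) * (R - 1) ^ 2 < (v - 1) * (x * R ^ 2 + v - x) := h1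
        _ = _ := by field_simp
  have hqt' : ∀ h y, qt h y = η * q h y + (1 - η) / v * ∑ x, q x y := by
    intro h y
    rw [hqt]
    simp [add_mul, Finset.sum_add_distrib, Finset.mul_sum]
  have hη' : 0 ≤ (1 - η) / v := div_nonneg (by linarith) (by linarith)
  have hcol : ∀ y, 0 ≤ ∑ x, q x y := fun y => Finset.sum_nonneg fun x _ => hq_nonneg x y
  have hqt0 : ∀ h y, 0 ≤ qt h y := fun h y => by
    rw [hqt']
    exact add_nonneg (mul_nonneg hη0.le (hq_nonneg h y)) (mul_nonneg hη' (hcol y))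
  have htot : ∑ y, ∑ x, q x y = v := by rw [Finset.sum_comm]; simp [hq_row]
  have hqt1 : ∀ h, ∑ y, qt h y = 1 := fun h => by
    simp only [hqt', Finset.sum_add_distrib, ← Finset.mul_sum, hq_row, htot]
    field_simp
    ring
  have hqtE : ∀ h h' y, qt h y ≤ R ^ 2 * qt h' y := fun h h' y => by
    rw [hqt', hqt']
    nlinarith [mul_le_mul_of_nonneg_left (hq_ldp h h' y) hη0.le,
      mul_nonneg (mul_nonneg hη' (hcol y)) (sub_nonneg.2 hE.le)]
  obtain ⟨h, h', hne, hT⟩ := exists_pair_le_of_sum_le hv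
    (T := fun h h' => ∑ y, |q h y - q h' y|) (B := 2 * (R ^ 2 - 1) * M) (by simp) (by
      calc ∑ h, ∑ h', ∑ y, |q h y - q h' y| = ∑ y, ∑ h, ∑ h', |q h y - q h' y| := by
            rw [Finset.sum_comm]
            simp_rw [Finset.sum_comm (s := (Finset.univ : Finset (Fin b)))]
            rw [Finset.sum_comm]
        _ ≤ ∑ y, 2 * (R ^ 2 - 1) * M / v * ∑ x, q x y :=
            Finset.sum_le_sum fun y _ => sum_abs_sub_le_of_ratio_le (by omega) hE hM
              (fun i => hq_nonneg i y) fun i j => hq_ldp i j y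
        _ = _ := by rw [← Finset.mul_sum, htot]; field_simp)
  have hdiff : ∑ y, |qt h y - qt h' y| = η * ∑ y, |q h y - q h' y| := by
    rw [Finset.mul_sum]
    refine Finset.sum_congr rfl fun y _ => ?_
    rw [hqt', hqt', add_sub_add_right_eq_sub, ← mul_sub, abs_mul, abs_of_pos hη0]
  have hX : 0 ≤ (R - 1) ^ 2 * M / (v * (v - 1)) := by positivity
  have hX1 : (R - 1) ^ 2 * M / (v * (v - 1)) < 1 := by
    rw [div_lt_one (by positivity)]; exact hM1
  have hη2 : η ≤ (v + η ^ 2 - 1) / v := by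
    rw [le_div_iff₀ (by linarith)]
    nlinarith [mul_nonneg (sub_nonneg.2 hη1) (by linarith : (0 : ℝ) ≤ v - 1 - η)]
  have hη3 : (v + η ^ 2 - 1) / v ≤ 1 := by
    rw [div_le_one (by linarith)]; nlinarith
  have hform : ((v : ℝ) + η ^ 2 - 1) * (R - 1) ^ 2 / ((v : ℝ) ^ 2 * ((v : ℝ) - 1)) * M =
      (v + η ^ 2 - 1) / v * ((R - 1) ^ 2 * M / (v * (v - 1))) := by
    field_simp
  rw [hform]
  have hlow : 1 - (v + η ^ 2 - 1) / v * ((R - 1) ^ 2 * M / (v * (v - 1))) ≤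
      sInf ((fun s : ℝ => ∑ y, (qt h y) ^ s * (qt h' y) ^ (1 - s)) '' Set.Icc (0 : ℝ) 1) := by
    refine le_csInf ((Set.nonempty_Icc.2 zero_le_one).image _) ?_
    rintro _ ⟨s, ⟨hs0, hs1⟩, rfl⟩
    refine le_trans ?_ (one_sub_totalVariation_le_sum_rpow hR (hqt0 h) (hqt0 h') (hqt1 h)
      (hqt1 h') (hqtE h h') (hqtE h' h) hs0 hs1)
    rw [hdiff]
    have hκ : 0 ≤ (R - 1) / (R + 1) := div_nonneg (by linarith) (by linarith)
    have h1 := mul_le_mul_of_nonneg_right hT (mul_nonneg (half_pos hη0).le hκ)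
    have h2 : 2 * (R ^ 2 - 1) * M / (v * (v - 1)) * (η / 2 * ((R - 1) / (R + 1))) =
        η * ((R - 1) ^ 2 * M / (v * (v - 1))) := by
      field_simp
      ring
    have h3 := mul_le_mul_of_nonneg_right hη2 hX
    rw [h2] at h1
    linarith
  refine le_trans (csInf_le ?_ ⟨h, h', hne, rfl⟩) (neg_le_neg (Real.log_le_log ?_ hlow))
  · refine ((Set.finite_range fun x : Fin v × Fin v =>
      -Real.log (sInf ((fun s : ℝ => ∑ y, (qt x.1 y) ^ s * (qt x.2 y) ^ (1 - s)) ''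
        Set.Icc (0 : ℝ) 1))).subset ?_).bddBelow
    rintro _ ⟨i, j, -, rfl⟩
    exact ⟨(i, j), rfl⟩
  · nlinarith [mul_le_mul_of_nonneg_right hη3 hX]
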